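/- In a finite SAS parity game, memoryless strategies are sufficient for Player 1: if Player 1 wins from a configuration v, then Player 1 has a memoryless winning strategy from v, i.e., a memoryless strategy π such that for every Player-0 strategy σ, either some play from v consistent with σ and π is not in W_s, or Prob_{v(σ,π)}(W_as) < 1. -/

import Mathlib

open MeasureTheory

/-- The set of elements occurring infinitely often in an infinite sequence. -/
def InfOcc {α : Type*} (s : ℕ → α) : Set α := {v | ∀ n, ∃ m, n ≤ m ∧ s m = v}

/-- The minimal priority occurring infinitely often. -/
noncomputable def minPrio {α : Type*} (p : α → ℕ) (s : ℕ → α) : ℕ := sInf (p '' InfOcc s)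

/-- The parity condition induced by a priority function. -/
def ParityWin {α : Type*} (p : α → ℕ) : Set (ℕ → α) := {s | Even (minPrio p s)}

/-- The history of a play up to (excluding) time `n`. -/
def hist {α : Type*} (p : ℕ → α) (n : ℕ) : List α := (List.range n).map p

/-- A finite stochastic game graph together with two priority functions:
`ps` inducing the sure parity condition and `pas` inducing the almost-sure one. -/
structure SASGame (V : Type) [Fintype V] where
  V0 : Set V
  V1 : Set V
  Vp : Set V
  cover : V0 ∪ V1 ∪ Vp = Set.univ
  disj01 : Disjoint V0 V1
  disj0p : Disjoint V0 Vp
  disj1p : Disjoint V1 Vp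
  E : V → V → Prop
  succ_nonempty : ∀ v, ∃ w, E v w
  κ : V → V → ENNReal
  κ_pos : ∀ v ∈ Vp, ∀ w, (0 < κ v w ↔ E v w)
  κ_sum : ∀ v ∈ Vp, ∑ w, κ v w = 1
  ps : V → ℕ
  pas : V → ℕ

variable {V : Type} [Fintype V]

/-- A strategy: given the past history and the current configuration, choose a successor. -/
abbrev Strat (V : Type) := List V → V → V

/-- A valid Player-0 strategy respects the edge relation on Player-0 configurations. -/
def SASGame.Valid0 (G : SASGame V) (σ : Strat V) : Prop := ∀ h v, v ∈ G.V0 → G.E v (σ h v)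

/-- A valid Player-1 strategy respects the edge relation on Player-1 configurations. -/
def SASGame.Valid1 (G : SASGame V) (π : Strat V) : Prop := ∀ h v, v ∈ G.V1 → G.E v (π h v)

/-- A strategy is memoryless if it only depends on the current configuration. -/
def Memoryless {V : Type} (σ : Strat V) : Prop := ∀ h h' v, σ h v = σ h' v

/-- `v(σ)`: the plays from `v` consistent with the Player-0 strategy `σ`. -/
def SASGame.PlaysFrom (G : SASGame V) (v : V) (σ : Strat V) : Set (ℕ → V) :=
  {p | p 0 = v ∧ (∀ n, G.E (p n) (p (n + 1))) ∧
    ∀ n, p n ∈ G.V0 → p (n + 1) = σ (hist p n) (p n)}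

/-- The plays from `v` consistent with both strategies `σ` and `π`. -/
def SASGame.Plays2 (G : SASGame V) (v : V) (σ π : Strat V) : Set (ℕ → V) :=
  {p | p ∈ G.PlaysFrom v σ ∧ ∀ n, p n ∈ G.V1 → p (n + 1) = π (hist p n) (p n)}

open Classical in
/-- One-step transition probability of the Markov chain `v(σ,π)`. -/
noncomputable def SASGame.step (G : SASGame V) (σ π : Strat V)
    (past : List V) (cur nxt : V) : ENNReal :=
  if cur ∈ G.V0 then (if nxt = σ past cur then 1 else 0)
  else if cur ∈ G.V1 then (if nxt = π past cur then 1 else 0)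
  else G.κ cur nxt

open Classical in
/-- Probability of the cylinder determined by the first `n+1` configurations of `h`. -/
noncomputable def SASGame.cylProb (G : SASGame V) (v : V) (σ π : Strat V)
    (h : ℕ → V) (n : ℕ) : ENNReal :=
  (if h 0 = v then 1 else 0) * ∏ i ∈ Finset.range n, G.step σ π (hist h i) (h i) (h (i + 1))

/-- The product σ-algebra on plays. -/
def playMS (V : Type) : MeasurableSpace (ℕ → V) :=
  @MeasurableSpace.pi ℕ (fun _ => V) (fun _ => ⊤)

/-- `μ` is the probability measure of the Markov chain `v(σ,π)`: it is the (unique)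
probability measure on plays assigning to every cylinder the product of the
transition probabilities along it. -/
def SASGame.IsPlayMeasure (G : SASGame V) (v : V) (σ π : Strat V)
    (μ : @Measure (ℕ → V) (playMS V)) : Prop :=
  μ Set.univ = 1 ∧
    ∀ (h : ℕ → V) (n : ℕ), μ {p | ∀ i ≤ n, p i = h i} = G.cylProb v σ π h n

/-- Player 0 wins from `v` with strategy `σ`. -/
def SASGame.Wins0Via (G : SASGame V) (v : V) (σ : Strat V) : Prop :=
  G.Valid0 σ ∧ G.PlaysFrom v σ ⊆ ParityWin G.ps ∧
    ∀ π, G.Valid1 π → ∀ μ, G.IsPlayMeasure v σ π μ → μ (ParityWin G.pas) = 1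

/-- Player 0 wins from `v`: she has a strategy `σ` such that all plays consistent with
`σ` satisfy the sure parity condition and, against every Player-1 strategy, the
almost-sure parity condition holds with probability 1. -/
def SASGame.Wins0 (G : SASGame V) (v : V) : Prop := ∃ σ, G.Wins0Via v σ

/-- Player 1 wins from `v` with strategy `π`. -/
def SASGame.Wins1Via (G : SASGame V) (v : V) (π : Strat V) : Prop :=
  G.Valid1 π ∧ ∀ σ, G.Valid0 σ →
    (∃ p ∈ G.Plays2 v σ π, p ∉ ParityWin G.ps) ∨
    (∀ μ, G.IsPlayMeasure v σ π μ → μ (ParityWin G.pas) < 1)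

/-- Player 1 wins from `v`. -/
def SASGame.Wins1 (G : SASGame V) (v : V) : Prop := ∃ π, G.Wins1Via v π

section Runs

variable {V : Type}

/-- The sequence generated from `v` by a successor function reading the past and the
current element. -/
def runState (v : V) (f : Strat V) : ℕ → List V × V
  | 0 => ([], v)
  | n + 1 => ((runState v f n).1 ++ [(runState v f n).2], f (runState v f n).1 (runState v f n).2)

/-- The sequence of current elements of `runState`. -/
def run (v : V) (f : Strat V) (n : ℕ) : V := (runState v f n).2

theorem hist_succ (p : ℕ → V) (n : ℕ) : hist p (n + 1) = hist p n ++ [p n] := by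
  simp [hist, List.range_succ]

theorem hist_length (p : ℕ → V) (n : ℕ) : (hist p n).length = n := by
  simp [hist]

theorem hist_ne_of_lt (p : ℕ → V) {i j : ℕ} (hij : i < j) : hist p i ≠ hist p j := fun h => by
  have := congrArg List.length h
  rw [hist_length, hist_length] at this
  omega

theorem hist_congr {p q : ℕ → V} {n : ℕ} (h : ∀ i < n, p i = q i) :
    hist p n = hist q n := by
  simp only [hist, List.map_inj_left, List.mem_range]
  exact h

theorem runState_fst (v : V) (f : Strat V) (n : ℕ) :
    (runState v f n).1 = hist (run v f) n := by
  induction n with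
  | zero => rfl
  | succ n ih => rw [hist_succ, ← ih]; rfl

theorem run_zero (v : V) (f : Strat V) : run v f 0 = v := rfl

theorem run_succ (v : V) (f : Strat V) (n : ℕ) :
    run v f (n + 1) = f (hist (run v f) n) (run v f n) := by
  rw [← runState_fst]; rfl

theorem run_eq_iff (v : V) (f : Strat V) (h : ℕ → V) (n : ℕ) :
    (∀ i ≤ n, run v f i = h i) ↔ h 0 = v ∧ ∀ i < n, f (hist h i) (h i) = h (i + 1) := by
  induction n with
  | zero => simp [run_zero, eq_comm]
  | succ n ih =>
    constructor
    · intro H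
      obtain ⟨h0, h1⟩ := ih.1 fun i hi => H i (by omega)
      refine ⟨h0, fun i hi => ?_⟩
      rcases Nat.lt_succ_iff_lt_or_eq.1 hi with hi | rfl
      · exact h1 i hi
      · rw [← H (i + 1) le_rfl, run_succ, H i (by omega),
          hist_congr fun j hj => H j (by omega)]
    · rintro ⟨h0, h1⟩
      have H := ih.2 ⟨h0, fun i hi => h1 i (by omega)⟩
      intro i hi
      rcases Nat.le_succ_iff.1 hi with hi | rfl
      · exact H i hi
      · rw [run_succ, H n le_rfl, hist_congr fun j hj => H j (by omega)]
        exact h1 n (by omega)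

theorem eq_run {v : V} {f : Strat V} {q : ℕ → V} (h0 : q 0 = v)
    (h1 : ∀ i, f (hist q i) (q i) = q (i + 1)) : q = run v f := by
  funext n
  exact ((run_eq_iff v f q n).2 ⟨h0, fun i _ => h1 i⟩ n le_rfl).symm

/-- The sequence following `h` before time `k` and `p` afterwards. -/
def glue (h : ℕ → V) (k : ℕ) (p : ℕ → V) (n : ℕ) : V := if n < k then h n else p (n - k)

theorem glue_add (h : ℕ → V) (k : ℕ) (p : ℕ → V) (n : ℕ) : glue h k p (k + n) = p n := by
  simp [glue]

theorem glue_of_le {h : ℕ → V} {k : ℕ} {p : ℕ → V} (h0 : p 0 = h k) {n : ℕ} (hn : n ≤ k) :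
    glue h k p n = h n := by
  rcases Nat.lt_or_eq_of_le hn with hn | rfl
  · simp [glue, hn]
  · simp [glue, h0]

theorem hist_add (q : ℕ → V) (k n : ℕ) :
    hist q (k + n) = hist q k ++ hist (fun i => q (k + i)) n := by
  simp [hist, List.range_add, Function.comp_def]

theorem hist_glue_add {h : ℕ → V} {k : ℕ} {p : ℕ → V} (h0 : p 0 = h k) (n : ℕ) :
    hist (glue h k p) (k + n) = hist h k ++ hist p n := by
  rw [hist_add, hist_congr fun i hi => glue_of_le h0 (le_of_lt hi)]
  simp only [glue_add]

theorem InfOcc_shift (q : ℕ → V) (k : ℕ) : InfOcc (fun n => q (k + n)) = InfOcc q := by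
  ext v
  constructor
  · intro h n
    obtain ⟨m, hm, rfl⟩ := h n
    exact ⟨k + m, by omega, rfl⟩
  · intro h n
    obtain ⟨m, hm, rfl⟩ := h (k + n)
    exact ⟨m - k, by omega, by simp only; congr 1; omega⟩

theorem parityWin_shift (r : V → ℕ) (q : ℕ → V) (k : ℕ) :
    (fun n => q (k + n)) ∈ ParityWin r ↔ q ∈ ParityWin r := by
  change Even (minPrio r _) ↔ Even (minPrio r _)
  rw [minPrio, minPrio, InfOcc_shift]

end Runs

section Split

open Classical

variable {V : Type} (w x : V)

/-- The component (`true` or `false`) to which the `n`-th step of a sequence belongs: steps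
from `w` to `x` are in component `true`, the other steps from `w` are in component `false`,
and the remaining steps are in the component of the preceding step. -/
noncomputable def comp (p : ℕ → V) : ℕ → Bool
  | 0 => if p 0 = w then decide (p 1 = x) else true
  | n + 1 => if p (n + 1) = w then decide (p (n + 2) = x) else comp p n

/-- The sources of the steps of component `c` before time `n`. -/
noncomputable def compPast (p : ℕ → V) (c : Bool) : ℕ → List V
  | 0 => []
  | n + 1 => if comp w x p n = c then compPast p c n ++ [p n] else compPast p c n

/-- The sequence starting with the list `h` and continuing with the constant `u`. -/
def pad (h : List V) (u : V) (n : ℕ) : V := h.getD n u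

/-- Combine one function of the past and the current element for each component into one. -/
noncomputable def merge {α : Type*} (S : Bool → List V → V → α) : List V → V → α := fun h u =>
  S (comp w x (pad h u) h.length)
    (compPast w x (pad h u) (comp w x (pad h u) h.length) h.length) u

variable {w x}

theorem comp_of_eq {p : ℕ → V} {n : ℕ} (h : p n = w) :
    comp w x p n = decide (p (n + 1) = x) := by
  cases n <;> simp [comp, h]

theorem comp_succ_of_ne {p : ℕ → V} {n : ℕ} (h : p (n + 1) ≠ w) :
    comp w x p (n + 1) = comp w x p n := by
  simp [comp, h]

theorem comp_congr {p q : ℕ → V} {n : ℕ} (h : ∀ i ≤ n, p i = q i)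
    (h' : p n = w → p (n + 1) = q (n + 1)) : comp w x p n = comp w x q n := by
  induction n with
  | zero =>
    by_cases h0 : p 0 = w
    · rw [comp_of_eq h0, comp_of_eq (by rw [← h 0 le_rfl, h0]), h' h0]
    · simp [comp, h0, ← h 0 le_rfl]
  | succ n ih =>
    by_cases h0 : p (n + 1) = w
    · rw [comp_of_eq h0, comp_of_eq (by rw [← h _ le_rfl, h0]), h' h0]
    · rw [comp_succ_of_ne h0, comp_succ_of_ne (by rwa [← h _ le_rfl])]
      exact ih (fun i hi => h i (by omega)) fun _ => h _ le_rfl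

theorem compPast_congr {p q : ℕ → V} {c : Bool} {n : ℕ} (h : ∀ i ≤ n, p i = q i) :
    compPast w x p c n = compPast w x q c n := by
  induction n with
  | zero => rfl
  | succ n ih =>
    simp only [compPast]
    rw [comp_congr (fun i hi => h i (by omega)) fun _ => h _ le_rfl,
      ih fun i hi => h i (by omega), h n (by omega)]

theorem pad_hist (p : ℕ → V) (n i : ℕ) (hi : i ≤ n) : pad (hist p n) (p n) i = p i := by
  unfold pad
  rcases Nat.lt_or_eq_of_le hi with hi | rfl
  · rw [List.getD_eq_getElem _ _ (by rwa [hist_length])]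
    simp [hist]
  · rw [List.getD_eq_default _ _ (by rw [hist_length])]

theorem comp_pad {p : ℕ → V} {n : ℕ} (hw : p n ≠ w) :
    comp w x (pad (hist p n) (p n)) (hist p n).length = comp w x p n := by
  rw [hist_length]
  refine comp_congr (pad_hist p n) fun h => (hw ?_).elim
  rwa [← pad_hist p n n le_rfl]

theorem compPast_pad (p : ℕ → V) (c : Bool) (n : ℕ) :
    compPast w x (pad (hist p n) (p n)) c (hist p n).length = compPast w x p c n := by
  rw [hist_length]
  exact compPast_congr (pad_hist p n)

theorem merge_hist {α : Type*} (S : Bool → List V → V → α) {p : ℕ → V} {n : ℕ} (hw : p n ≠ w) :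
    merge w x S (hist p n) (p n) =
      S (comp w x p n) (compPast w x p (comp w x p n) n) (p n) := by
  unfold merge
  rw [comp_pad hw, compPast_pad]

theorem compPast_succ_of_eq {p : ℕ → V} {c : Bool} {n : ℕ} (h : comp w x p n = c) :
    compPast w x p c (n + 1) = compPast w x p c n ++ [p n] := by
  simp [compPast, h]

theorem compPast_eq_of_forall_ne {p : ℕ → V} {c : Bool} {m n : ℕ} (hmn : m ≤ n)
    (h : ∀ t, m ≤ t → t < n → comp w x p t ≠ c) :
    compPast w x p c n = compPast w x p c m := by
  induction n, hmn using Nat.le_induction with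
  | base => rfl
  | succ n hmn ih =>
    rw [← ih fun t h1 h2 => h t h1 (by omega)]
    simp [compPast, h n hmn (by omega)]

theorem compPast_prefix {p : ℕ → V} {c : Bool} {m n : ℕ} (hmn : m ≤ n) :
    compPast w x p c m <+: compPast w x p c n := by
  induction n, hmn using Nat.le_induction with
  | base => exact List.prefix_rfl
  | succ n hmn ih =>
    refine ih.trans ?_
    simp only [compPast]
    split_ifs
    · exact List.prefix_append _ _
    · exact List.prefix_rfl

theorem compPast_length_lt {p : ℕ → V} {c : Bool} {m n : ℕ} (hmn : m < n)
    (h : comp w x p m = c) :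
    (compPast w x p c m).length < (compPast w x p c n).length := by
  have := (compPast_prefix (w := w) (x := x) (p := p) (c := c) hmn).length_le
  rw [compPast_succ_of_eq h, List.length_append, List.length_singleton] at this
  omega

/-- A component resumes at the vertex where it was left. -/
theorem eq_of_consecutive {p : ℕ → V} {c : Bool} {m n : ℕ} (hmn : m < n)
    (hm : comp w x p m = c) (hn : comp w x p n = c)
    (h : ∀ t, m < t → t < n → comp w x p t ≠ c) : p n = p (m + 1) := by
  rcases Nat.eq_or_lt_of_le (Nat.succ_le_of_lt hmn) with rfl | hlt
  · rfl
  · have h1 : p (m + 1) = w := by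
      by_contra hne
      exact h (m + 1) (by omega) hlt ((comp_succ_of_ne hne).trans hm)
    obtain ⟨k, rfl⟩ : ∃ k, n = k + 1 := ⟨n - 1, by omega⟩
    have h2 : p (k + 1) = w := by
      by_contra hne
      exact h k (by omega) (by omega) ((comp_succ_of_ne hne).symm.trans hn)
    rw [h1, h2]

/-- The vertex at which a component of a sequence from `v` starts. -/
def compStart (v w : V) (c : Bool) : V := if c then v else w

theorem eq_compStart {p : ℕ → V} {c : Bool} {n : ℕ} (hn : comp w x p n = c)
    (h : ∀ t < n, comp w x p t ≠ c) : p n = compStart (p 0) w c := by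
  by_cases hw : p n = w
  · cases c with
    | false => simp [compStart, hw]
    | true =>
      rcases Nat.eq_zero_or_pos n with rfl | hpos
      · simp [compStart]
      · by_cases h0 : p 0 = w
        · simp [compStart, h0, hw]
        · exact (h 0 hpos (by simp [comp, h0])).elim
  · cases n with
    | zero =>
      have : c = true := by rw [← hn]; simp [comp, hw]
      simp [compStart, this]
    | succ n => exact (h n (by omega) ((comp_succ_of_ne hw).symm.trans hn)).elim

theorem compPast_next {p : ℕ → V} {c : Bool} {m n : ℕ} (hmn : m < n)
    (hm : comp w x p m = c) (hn : comp w x p n = c) :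
    (compPast w x p c n ++ [p n])[(compPast w x p c m).length + 1]? = some (p (m + 1)) := by
  have hex : ∃ t, m < t ∧ comp w x p t = c := ⟨n, hmn, hn⟩
  obtain ⟨ht1, ht2⟩ := Nat.find_spec hex
  have hmin := fun {s} => Nat.find_min hex (m := s)
  have hle : Nat.find hex ≤ n := Nat.find_min' hex ⟨hmn, hn⟩
  generalize Nat.find hex = t at *
  have hbet : ∀ s, m < s → s < t → comp w x p s ≠ c := fun s h1 h2 h3 => hmin h2 ⟨h1, h3⟩
  have e1 := eq_of_consecutive ht1 hm ht2 hbet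
  have e2 : compPast w x p c t = compPast w x p c m ++ [p m] := by
    rw [← compPast_succ_of_eq hm]
    exact compPast_eq_of_forall_ne ht1 fun s h1 h2 => hbet s h1 h2
  have e3 : compPast w x p c m ++ [p m] ++ [p t] <+: compPast w x p c n ++ [p n] := by
    rw [← e2, ← compPast_succ_of_eq ht2, ← compPast_succ_of_eq hn]
    exact compPast_prefix (by omega)
  rw [← e1]
  obtain ⟨l, hl⟩ := e3
  rw [← hl]
  simp

/-- The subsequence of the sources of the steps of component `c`. -/
noncomputable def proj (w x : V) (p : ℕ → V) (c : Bool) (k : ℕ) : V :=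
  p (Nat.nth (fun n => comp w x p n = c) k)

theorem hist_proj_count (p : ℕ → V) (c : Bool) (n : ℕ) :
    hist (proj w x p c) (Nat.count (fun n => comp w x p n = c) n) = compPast w x p c n := by
  induction n with
  | zero => simp [hist, compPast]
  | succ n ih =>
    rw [Nat.count_succ]
    by_cases h : comp w x p n = c
    · rw [if_pos h, hist_succ, ih, compPast_succ_of_eq h, proj, Nat.nth_count h]
    · simp only [if_neg h, Nat.add_zero, compPast, ih]

theorem hist_proj {p : ℕ → V} {c : Bool} (hinf : {n | comp w x p n = c}.Infinite) (k : ℕ) :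
    hist (proj w x p c) k =
      compPast w x p c (Nat.nth (fun n => comp w x p n = c) k) := by
  rw [← hist_proj_count, Nat.count_nth_of_infinite hinf]

theorem proj_zero {p : ℕ → V} {c : Bool} (hinf : {n | comp w x p n = c}.Infinite) :
    proj w x p c 0 = compStart (p 0) w c := by
  refine eq_compStart (Nat.nth_mem_of_infinite hinf 0) fun t ht hc => ?_
  have := Nat.nth_count (p := fun n => comp w x p n = c) hc
  have h2 := (Nat.nth_strictMono hinf).monotone
    (Nat.zero_le (Nat.count (fun n => comp w x p n = c) t))
  omega

theorem proj_succ {p : ℕ → V} {c : Bool} (hinf : {n | comp w x p n = c}.Infinite) (k : ℕ) :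
    proj w x p c (k + 1) = p (Nat.nth (fun n => comp w x p n = c) k + 1) := by
  refine eq_of_consecutive (Nat.nth_strictMono hinf k.lt_succ_self)
    (Nat.nth_mem_of_infinite hinf k) (Nat.nth_mem_of_infinite hinf (k + 1)) fun t h1 h2 hc => ?_
  have := Nat.nth_count (p := fun n => comp w x p n = c) hc
  rw [← this] at h1 h2
  have h3 := (Nat.nth_strictMono hinf).lt_iff_lt.1 h1
  have h4 := (Nat.nth_strictMono hinf).lt_iff_lt.1 h2
  omega

/-- The vertices from which a step of component `c` is made infinitely often. -/
def InfComp (w x : V) (c : Bool) (p : ℕ → V) : Set V :=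
  {v | ∀ n, ∃ m, n ≤ m ∧ comp w x p m = c ∧ p m = v}

theorem InfOcc_proj {p : ℕ → V} {c : Bool} (hinf : {n | comp w x p n = c}.Infinite) :
    InfOcc (proj w x p c) = InfComp w x c p := by
  ext v
  constructor
  · intro h n
    obtain ⟨m, hm, rfl⟩ := h n
    exact ⟨_, hm.trans (Nat.nth_strictMono hinf).le_apply, Nat.nth_mem_of_infinite hinf m, rfl⟩
  · intro h n
    obtain ⟨m, hm, hc, rfl⟩ := h (Nat.nth (fun n => comp w x p n = c) n)
    refine ⟨Nat.count (fun n => comp w x p n = c) m, ?_, ?_⟩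
    · rw [← Nat.count_nth_of_infinite hinf n]
      exact Nat.count_monotone _ hm
    · rw [proj, Nat.nth_count (p := fun n => comp w x p n = c) hc]

theorem infinite_of_mem_InfComp {p : ℕ → V} {c : Bool} {v : V} (h : v ∈ InfComp w x c p) :
    {n | comp w x p n = c}.Infinite := by
  refine Set.infinite_of_forall_exists_gt fun n => ?_
  obtain ⟨m, hm, hc, -⟩ := h (n + 1)
  exact ⟨m, hc, hm⟩

theorem InfOcc_eq_union (p : ℕ → V) :
    InfOcc p = InfComp w x true p ∪ InfComp w x false p := by
  ext v
  constructor
  · intro h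
    by_contra hcon
    simp only [Set.mem_union, not_or, InfComp, Set.mem_ofPred_eq] at hcon
    push Not at hcon
    obtain ⟨⟨a, ha⟩, ⟨b, hb⟩⟩ := hcon
    obtain ⟨m, hm, rfl⟩ := h (max a b)
    cases hc : comp w x p m with
    | true => exact ha m (le_of_max_le_left hm) hc rfl
    | false => exact hb m (le_of_max_le_right hm) hc rfl
  · rintro (h | h) n <;>
    · obtain ⟨m, hm, -, rfl⟩ := h n
      exact ⟨m, hm, rfl⟩

theorem InfOcc_nonempty [Finite V] (p : ℕ → V) : (InfOcc p).Nonempty := by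
  obtain ⟨v, hv⟩ := Finite.exists_infinite_fiber p
  refine ⟨v, fun n => ?_⟩
  rw [Set.infinite_coe_iff] at hv
  obtain ⟨m, hm, hlt⟩ := hv.exists_gt n
  exact ⟨m, hlt.le, hm⟩

theorem even_sInf_image_union {r : V → ℕ} {A B : Set V} (hne : (A ∪ B).Nonempty)
    (hA : A.Nonempty → Even (sInf (r '' A))) (hB : B.Nonempty → Even (sInf (r '' B))) :
    Even (sInf (r '' (A ∪ B))) := by
  rw [Set.image_union]
  rcases A.eq_empty_or_nonempty with rfl | hAne
  · rw [Set.image_empty, Set.empty_union]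
    exact hB (by simpa using hne)
  rcases B.eq_empty_or_nonempty with rfl | hBne
  · rw [Set.image_empty, Set.union_empty]
    exact hA hAne
  rw [csInf_union (OrderBot.bddBelow _) (hAne.image r) (OrderBot.bddBelow _) (hBne.image r)]
  rcases min_choice (sInf (r '' A)) (sInf (r '' B)) with h | h
  · exact (congrArg Even h).mpr (hA hAne)
  · exact (congrArg Even h).mpr (hB hBne)

/-- A sequence satisfies a parity condition if its infinite components do. -/
theorem parityWin_of_components [Finite V] {r : V → ℕ} {p : ℕ → V}
    (h : ∀ c, (InfComp w x c p).Nonempty → Even (sInf (r '' InfComp w x c p))) :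
    p ∈ ParityWin r := by
  have hne := InfOcc_nonempty p
  rw [InfOcc_eq_union (w := w) (x := x)] at hne
  change Even (sInf (r '' InfOcc p))
  rw [InfOcc_eq_union (w := w) (x := x)]
  exact even_sInf_image_union hne (h true) (h false)

end Split

section Measure

open Classical

/-- The discrete σ-algebra on configurations. -/
local instance (priority := 10) discreteMS (V : Type) : MeasurableSpace V := ⊤

local instance (priority := 10) discreteMS_discrete (V : Type) : DiscreteMeasurableSpace V :=
  ⟨fun _ => trivial⟩

variable {V : Type}

/-- The sequences agreeing with `h` up to time `n`. -/
def cyl (h : ℕ → V) (n : ℕ) : Set (ℕ → V) := {p | ∀ i ≤ n, p i = h i}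

theorem measurableSet_cyl (h : ℕ → V) (n : ℕ) : MeasurableSet (cyl h n) := by
  have : cyl h n = ⋂ i ∈ Set.Iic n, (fun p : ℕ → V => p i) ⁻¹' {h i} := by
    ext p; simp [cyl]
  rw [this]
  exact .biInter (Set.to_countable _) fun i _ =>
    measurable_pi_apply i (MeasurableSet.of_discrete)

theorem isPiSystem_cyl : IsPiSystem {s : Set (ℕ → V) | ∃ h n, s = cyl h n} := by
  rintro _ ⟨h, n, rfl⟩ _ ⟨h', n', rfl⟩ ⟨p, hp, hp'⟩
  refine ⟨p, max n n', ?_⟩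
  ext q
  constructor
  · rintro ⟨hq, hq'⟩ i hi
    rcases le_max_iff.1 hi with hi | hi
    · rw [hq i hi, hp i hi]
    · rw [hq' i hi, hp' i hi]
  · intro hq
    exact ⟨fun i hi => by rw [hq i (hi.trans (le_max_left _ _)), hp i hi],
      fun i hi => by rw [hq i (hi.trans (le_max_right _ _)), hp' i hi]⟩

theorem preimage_eq_iUnion_cyl [Nonempty V] (i : ℕ) (S : Set V) :
    (fun p : ℕ → V => p i) ⁻¹' S =
      ⋃ l ∈ {l : Fin (i + 1) → V | l (Fin.last i) ∈ S},
        cyl (fun n => if h : n < i + 1 then l ⟨n, h⟩ else Classical.arbitrary V) i := by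
  ext p
  simp only [Set.mem_preimage, Set.mem_iUnion, Set.mem_ofPred_eq, exists_prop]
  constructor
  · intro hp
    refine ⟨fun j => p j, hp, fun j hj => ?_⟩
    simp [Nat.lt_succ_of_le hj]
  · rintro ⟨l, hl, hp⟩
    rw [hp i le_rfl]
    simpa [Fin.last] using hl

theorem generateFrom_cyl [Finite V] [Nonempty V] :
    (MeasurableSpace.pi : MeasurableSpace (ℕ → V)) =
      MeasurableSpace.generateFrom {s | ∃ h n, s = cyl h n} := by
  apply le_antisymm
  · refine iSup_le fun i => ?_
    rintro _ ⟨S, -, rfl⟩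
    rw [preimage_eq_iUnion_cyl]
    exact MeasurableSet.biUnion (Set.to_countable _) fun l _ =>
      MeasurableSpace.measurableSet_generateFrom ⟨_, _, rfl⟩
  · refine MeasurableSpace.generateFrom_le ?_
    rintro _ ⟨h, n, rfl⟩
    exact measurableSet_cyl h n

theorem measurableSet_frequently {A : ℕ → Set (ℕ → V)} (hA : ∀ m, MeasurableSet (A m)) :
    MeasurableSet {p | ∀ n, ∃ m, n ≤ m ∧ p ∈ A m} := by
  have : {p | ∀ n, ∃ m, n ≤ m ∧ p ∈ A m} = ⋂ n, ⋃ m ∈ Set.Ici n, A m := by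
    ext p; simp
  rw [this]
  exact .iInter fun n => .biUnion (Set.to_countable _) fun m _ => hA m

theorem measurableSet_coord (m : ℕ) (v : V) : MeasurableSet {p : ℕ → V | p m = v} :=
  (measurable_pi_apply m : Measurable fun p : ℕ → V => p m)
    (MeasurableSet.of_discrete (s := {v}))

theorem measurableSet_comp (w x : V) (c : Bool) (n : ℕ) :
    MeasurableSet {p : ℕ → V | comp w x p n = c} := by
  suffices h : Measurable fun p : ℕ → V => comp w x p n from
    h (MeasurableSet.of_discrete (s := {c}))
  have hd : ∀ m, Measurable fun p : ℕ → V => decide (p m = x) := fun m =>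
    (measurable_from_top (f := fun u : V => decide (u = x))).comp (measurable_pi_apply m)
  induction n with
  | zero => exact Measurable.ite (measurableSet_coord 0 w) (hd 1) measurable_const
  | succ n ih => exact Measurable.ite (measurableSet_coord (n + 1) w) (hd (n + 2)) ih

variable [Fintype V]

theorem SASGame.IsPlayMeasure.cyl_eq {G : SASGame V} {v : V} {σ π : Strat V}
    {μ : Measure (ℕ → V)} (hμ : G.IsPlayMeasure v σ π μ) (h : ℕ → V) (n : ℕ) :
    μ (cyl h n) = G.cylProb v σ π h n :=
  hμ.2 h n

theorem SASGame.IsPlayMeasure.isProbabilityMeasure {G : SASGame V} {v : V} {σ π : Strat V}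
    {μ : Measure (ℕ → V)} (hμ : G.IsPlayMeasure v σ π μ) : IsProbabilityMeasure μ := ⟨hμ.1⟩

theorem SASGame.IsPlayMeasure.unique {G : SASGame V} {v : V} {σ π : Strat V}
    {μ ν : Measure (ℕ → V)} (hμ : G.IsPlayMeasure v σ π μ) (hν : G.IsPlayMeasure v σ π ν) :
    μ = ν := by
  have : Nonempty V := ⟨v⟩
  have := hμ.isProbabilityMeasure
  refine ext_of_generate_finite _ generateFrom_cyl isPiSystem_cyl ?_ (hμ.1.trans hν.1.symm)
  rintro _ ⟨h, n, rfl⟩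
  exact (hμ.cyl_eq h n).trans (hν.cyl_eq h n).symm

/-- A property of a random set of configurations is measurable if membership is. -/
theorem measurableSet_of_setValued {F : (ℕ → V) → Set V}
    (hF : ∀ v, MeasurableSet {p | v ∈ F p}) (Q : Set V → Prop) :
    MeasurableSet {p | Q (F p)} := by
  have hA : ∀ A : Set V, MeasurableSet {p | F p = A} := by
    intro A
    have : {p | F p = A} = ⋂ v, {p | v ∈ F p ↔ v ∈ A} := by
      ext p; simp [Set.ext_iff]
    rw [this]
    refine .iInter fun v => ?_
    by_cases hv : v ∈ A
    · simpa [hv] using hF v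
    · simpa [hv, Set.compl_def] using (hF v).compl
  have : {p | Q (F p)} = ⋃ A ∈ {A : Set V | Q A}, {p | F p = A} := by
    ext p; simp
  rw [this]
  exact .biUnion (Set.to_countable _) fun A _ => hA A

theorem measurableSet_parityWin (r : V → ℕ) : MeasurableSet (ParityWin r) :=
  measurableSet_of_setValued (F := InfOcc)
    (fun v => measurableSet_frequently fun m => measurableSet_coord m v)
    fun A => Even (sInf (r '' A))

theorem measurableSet_infComp (w x : V) (c : Bool) (Q : Set V → Prop) :
    MeasurableSet {p : ℕ → V | Q (InfComp w x c p)} :=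
  measurableSet_of_setValued (F := InfComp w x c)
    (fun v => measurableSet_frequently fun m =>
      (measurableSet_comp w x c m).inter (measurableSet_coord m v)) Q

theorem measurableSet_bad_component (w x : V) (c : Bool) (r : V → ℕ) :
    MeasurableSet {p : ℕ → V |
      ¬((InfComp w x c p).Nonempty → Even (sInf (r '' InfComp w x c p)))} :=
  measurableSet_infComp w x c fun A => ¬(A.Nonempty → Even (sInf (r '' A)))

/-- The successor function of a game in which the strategies of both players and the outcomes
of the probabilistic configurations are fixed. -/
noncomputable def SASGame.next (G : SASGame V) (σ π τ : Strat V) : Strat V := fun h u =>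
  if u ∈ G.V0 then σ h u else if u ∈ G.V1 then π h u else τ h u

theorem SASGame.mem_Vp (G : SASGame V) {u : V} (h0 : u ∉ G.V0) (h1 : u ∉ G.V1) :
    u ∈ G.Vp := by
  have : u ∈ G.V0 ∪ G.V1 ∪ G.Vp := by rw [G.cover]; trivial
  simpa [h0, h1] using this

/-- If the outcomes of the probabilistic configurations are read off an independent family of
random variables, without reading one variable twice, the resulting play has the law of the
Markov chain. -/
theorem SASGame.isPlayMeasure_map (G : SASGame V) {v : V} {σ π : Strat V} {Ω ι : Type*}
    [MeasurableSpace Ω] (P : Measure Ω) [IsProbabilityMeasure P] (X : ι → Ω → V)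
    (hX : ∀ i, Measurable (X i)) (k : ι → V → ENNReal)
    (hP : ∀ (J : Finset ℕ) (ψ : ℕ → ι) (b : ℕ → V), Set.InjOn ψ J →
      P {ω | ∀ j ∈ J, X (ψ j) ω = b j} = ∏ j ∈ J, k (ψ j) (b j))
    (φ : List V → V → ι) (hk : ∀ h, ∀ u ∈ G.Vp, k (φ h u) = G.κ u)
    (hφ : ∀ p : ℕ → V, ∀ i j, i < j → p i ∈ G.Vp → p j ∈ G.Vp →
      φ (hist p i) (p i) ≠ φ (hist p j) (p j)) :
    Measurable (fun ω => run v (G.next σ π fun h u => X (φ h u) ω)) ∧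
      G.IsPlayMeasure v σ π
        (P.map fun ω => run v (G.next σ π fun h u => X (φ h u) ω)) := by
  have : Nonempty V := ⟨v⟩
  set R : Ω → ℕ → V := fun ω => run v (G.next σ π fun h u => X (φ h u) ω) with hR
  have key : ∀ h n, MeasurableSet (R ⁻¹' cyl h n) ∧
      P (R ⁻¹' cyl h n) = G.cylProb v σ π h n := by
    intro h n
    have hpre : R ⁻¹' cyl h n = {ω | h 0 = v ∧ ∀ i < n,
        G.next σ π (fun h u => X (φ h u) ω) (hist h i) (h i) = h (i + 1)} := by
      ext ω
      exact run_eq_iff v _ h n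
    set J := (Finset.range n).filter fun i => h i ∈ G.Vp with hJ
    by_cases hdet : h 0 = v ∧ ∀ i < n, (h i ∈ G.V0 → σ (hist h i) (h i) = h (i + 1)) ∧
        (h i ∈ G.V1 → π (hist h i) (h i) = h (i + 1))
    · obtain ⟨h0, hd⟩ := hdet
      have hset : R ⁻¹' cyl h n =
          {ω | ∀ j ∈ J, X (φ (hist h j) (h j)) ω = h (j + 1)} := by
        rw [hpre]
        ext ω
        simp only [Set.mem_ofPred_eq, hJ, Finset.mem_filter, Finset.mem_range, h0, true_and]
        constructor
        · rintro H j ⟨hj, hp⟩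
          have := H j hj
          rwa [SASGame.next, if_neg (G.disj0p.notMem_of_mem_right hp),
            if_neg (G.disj1p.notMem_of_mem_right hp)] at this
        · intro H j hj
          unfold SASGame.next
          split_ifs with h1 h2
          · exact (hd j hj).1 h1
          · exact (hd j hj).2 h2
          · exact H j ⟨hj, G.mem_Vp h1 h2⟩
      refine ⟨?_, ?_⟩
      · rw [hset]
        have : {ω | ∀ j ∈ J, X (φ (hist h j) (h j)) ω = h (j + 1)} =
            ⋂ j ∈ J, X (φ (hist h j) (h j)) ⁻¹' {h (j + 1)} := by
          ext ω; simp
        rw [this]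
        exact Finset.measurableSet_biInter _ fun j _ => hX _ (MeasurableSet.of_discrete)
      · rw [hset, hP J (fun j => φ (hist h j) (h j)) (fun j => h (j + 1)), SASGame.cylProb,
          if_pos h0, one_mul, hJ, Finset.prod_filter]
        · refine Finset.prod_congr rfl fun j hj => ?_
          rw [Finset.mem_range] at hj
          unfold SASGame.step
          split_ifs with hp h1 h2 h3 h4 h5 h6 h7 h8
          all_goals first
            | rfl
            | exact (G.disj0p.notMem_of_mem_right hp h1).elim
            | exact (G.disj1p.notMem_of_mem_right hp ‹_›).elim
            | exact (hp (G.mem_Vp ‹_› ‹_›)).elim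
            | exact (‹¬ _ = _› ((hd j hj).1 ‹_›).symm).elim
            | exact (‹¬ _ = _› ((hd j hj).2 ‹_›).symm).elim
            | exact congrFun (hk _ _ hp) _
        · intro i hi j hj hij
          simp only [hJ, Finset.coe_filter, Finset.mem_range, Set.mem_ofPred_eq] at hi hj
          rcases lt_trichotomy i j with hlt | rfl | hlt
          · exact (hφ h i j hlt hi.2 hj.2 hij).elim
          · rfl
          · exact (hφ h j i hlt hj.2 hi.2 hij.symm).elim
    · have hset : R ⁻¹' cyl h n = ∅ := by
        rw [hpre, Set.eq_empty_iff_forall_notMem]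
        rintro ω ⟨h0, H⟩
        refine hdet ⟨h0, fun i hi => ?_⟩
        have := H i hi
        unfold SASGame.next at this
        constructor
        · intro h1
          rwa [if_pos h1] at this
        · intro h1
          rwa [if_neg (G.disj01.notMem_of_mem_right h1), if_pos h1] at this
      rw [hset]
      refine ⟨.empty, ?_⟩
      rw [measure_empty, eq_comm, SASGame.cylProb]
      by_cases h0 : h 0 = v
      · simp only [h0, true_and, not_forall, not_and_or] at hdet
        obtain ⟨i, hi, hne⟩ := hdet
        refine mul_eq_zero_of_right _ (Finset.prod_eq_zero (Finset.mem_range.2 hi) ?_)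
        unfold SASGame.step
        rcases hne with ⟨h1, hne⟩ | ⟨h1, hne⟩
        · rw [if_pos h1, if_neg (Ne.symm hne)]
        · rw [if_neg (G.disj01.notMem_of_mem_right h1), if_pos h1, if_neg (Ne.symm hne)]
      · rw [if_neg h0, zero_mul]
  have hmeas : Measurable R := by
    rw [generateFrom_cyl]
    refine measurable_generateFrom ?_
    rintro _ ⟨h, n, rfl⟩
    exact (key h n).1
  refine ⟨hmeas, ?_, fun h n => ?_⟩
  · exact (Measure.map_apply hmeas .univ).trans measure_univ
  · exact (Measure.map_apply hmeas (measurableSet_cyl h n)).trans (key h n).2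

/-- The law of the successor of a configuration (a Dirac mass if it is not probabilistic). -/
noncomputable def SASGame.succPMF (G : SASGame V) (u : V) : PMF V :=
  if h : u ∈ G.Vp then PMF.ofFintype (G.κ u) (G.κ_sum u h) else PMF.pure u

theorem SASGame.succPMF_apply (G : SASGame V) {u : V} (h : u ∈ G.Vp) (a : V) :
    G.succPMF u a = G.κ u a := by
  rw [SASGame.succPMF, dif_pos h, PMF.ofFintype_apply]

/-- The law of the independent outcomes of the probabilistic configurations, indexed by the
past and the current configuration. -/
noncomputable def SASGame.nature (G : SASGame V) : Measure (List V × V → V) :=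
  Measure.infinitePi fun i => (G.succPMF i.2).toMeasure

instance (G : SASGame V) : IsProbabilityMeasure G.nature := by
  unfold SASGame.nature; infer_instance

theorem SASGame.nature_apply (G : SASGame V) (J : Finset ℕ) (ψ : ℕ → List V × V) (b : ℕ → V)
    (hψ : Set.InjOn ψ J) :
    G.nature {τ | ∀ j ∈ J, τ (ψ j) = b j} = ∏ j ∈ J, G.succPMF (ψ j).2 (b j) := by
  rcases J.eq_empty_or_nonempty with rfl | hne
  · simp
  have : {τ : List V × V → V | ∀ j ∈ J, τ (ψ j) = b j} =
      Set.pi (J.image ψ) fun i => {b (Function.invFunOn ψ J i)} := by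
    ext τ
    simp only [Set.mem_ofPred_eq, Set.mem_pi, Finset.coe_image, Set.mem_image, Finset.mem_coe,
      Set.mem_singleton_iff, forall_exists_index, and_imp, forall_apply_eq_imp_iff₂]
    exact forall₂_congr fun j hj => by rw [hψ.leftInvOn_invFunOn hj]
  rw [this, SASGame.nature, Measure.infinitePi_pi _ fun _ _ => MeasurableSet.of_discrete,
    Finset.prod_image hψ]
  refine Finset.prod_congr rfl fun j hj => ?_
  rw [PMF.toMeasure_apply_singleton _ _ MeasurableSet.of_discrete, hψ.leftInvOn_invFunOn hj]

theorem SASGame.isPlayMeasure_nature (G : SASGame V) (v : V) (σ π : Strat V) :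
    Measurable (fun τ : List V × V → V => run v (G.next σ π fun h u => τ (h, u))) ∧
      G.IsPlayMeasure v σ π (G.nature.map fun τ => run v (G.next σ π fun h u => τ (h, u))) := by
  refine G.isPlayMeasure_map G.nature (fun i τ => τ i) (fun i => measurable_pi_apply i)
    (fun i => G.succPMF i.2) (fun J ψ b hψ => G.nature_apply J ψ b hψ) (fun h u => (h, u))
    (fun h u hu => funext (G.succPMF_apply hu)) fun p i j hij _ _ h => ?_
  exact hist_ne_of_lt p hij (Prod.ext_iff.1 h).1

theorem SASGame.exists_isPlayMeasure (G : SASGame V) (v : V) (σ π : Strat V) :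
    ∃ μ : Measure (ℕ → V), G.IsPlayMeasure v σ π μ :=
  ⟨_, (G.isPlayMeasure_nature v σ π).2⟩

/-- The outcomes of the two components, the one of component `c` coming second. -/
def twoOutcomes (c : Bool) (i : Bool × List V × V)
    (T : (List V × V → V) × (List V × V → V)) : V :=
  if i.1 = c then T.2 i.2 else T.1 i.2

theorem SASGame.prod_nature_apply (G : SASGame V) (c : Bool) (J : Finset ℕ)
    (ψ : ℕ → Bool × List V × V) (b : ℕ → V) (hψ : Set.InjOn ψ J) :
    (G.nature.prod G.nature) {T | ∀ j ∈ J, twoOutcomes c (ψ j) T = b j} =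
      ∏ j ∈ J, G.succPMF (ψ j).2.2 (b j) := by
  have hset : {T | ∀ j ∈ J, twoOutcomes c (ψ j) T = b j} =
      {τ | ∀ j ∈ J.filter fun j => ¬(ψ j).1 = c, τ (ψ j).2 = b j} ×ˢ
        {τ | ∀ j ∈ J.filter fun j => (ψ j).1 = c, τ (ψ j).2 = b j} := by
    ext T
    simp only [twoOutcomes, Set.mem_ofPred_eq, Set.mem_prod, Finset.mem_filter, and_imp]
    constructor
    · intro H
      exact ⟨fun j hj hc => by simpa [hc] using H j hj, fun j hj hc => by simpa [hc] using H j hj⟩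
    · rintro ⟨H1, H2⟩ j hj
      split_ifs with hc
      · exact H2 j hj hc
      · exact H1 j hj hc
  rw [hset, Measure.prod_prod, G.nature_apply _ (fun j => (ψ j).2),
    G.nature_apply _ (fun j => (ψ j).2), mul_comm, Finset.prod_filter_mul_prod_filter_not]
  · intro i hi j hj hij
    simp only [Finset.coe_filter, Set.mem_ofPred_eq] at hi hj
    exact hψ hi.1 hj.1 (Prod.ext (hi.2.trans hj.2.symm) hij)
  · intro i hi j hj hij
    simp only [Finset.coe_filter, Set.mem_ofPred_eq] at hi hj
    refine hψ hi.1 hj.1 (Prod.ext ?_ hij)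
    rw [Bool.eq_not.2 hi.2, Bool.eq_not.2 hj.2]

/-- The outcomes of the probabilistic configurations when each component has its own. -/
noncomputable def mergedOutcomes (w x : V) (c : Bool)
    (T : (List V × V → V) × (List V × V → V)) : Strat V :=
  merge w x fun b h u => twoOutcomes c (b, h, u) T

theorem SASGame.isPlayMeasure_merged (G : SASGame V) (v : V) (σ π : Strat V) {w : V}
    (hw : w ∈ G.V1) (x : V) (c : Bool) :
    Measurable (fun T => run v (G.next σ π (mergedOutcomes w x c T))) ∧
      G.IsPlayMeasure v σ π ((G.nature.prod G.nature).map fun T =>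
        run v (G.next σ π (mergedOutcomes w x c T))) := by
  refine G.isPlayMeasure_map (G.nature.prod G.nature) (twoOutcomes c) (fun i => ?_)
    (fun i => G.succPMF i.2.2) (fun J ψ b hψ => G.prod_nature_apply c J ψ b hψ)
    (merge w x fun b h u => (b, h, u)) (fun h u hu => funext (G.succPMF_apply hu))
    fun p i j hij hi hj h => ?_
  · unfold twoOutcomes
    split_ifs
    · exact (measurable_pi_apply _).comp measurable_snd
    · exact (measurable_pi_apply _).comp measurable_fst
  · have hwp : ∀ u ∈ G.Vp, u ≠ w := fun u hu hne =>
      G.disj1p.notMem_of_mem_left hw (hne ▸ hu)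
    rw [merge_hist _ (hwp _ hi), merge_hist _ (hwp _ hj)] at h
    simp only [Prod.mk.injEq] at h
    obtain ⟨h1, h2, -⟩ := h
    have := compPast_length_lt (w := w) (x := x) (p := p) hij rfl
    rw [h2, h1] at this
    exact this.false

theorem SASGame.step_ne_zero_iff (G : SASGame V) (σ π : Strat V) (l : List V) (u u' : V) :
    G.step σ π l u u' ≠ 0 ↔
      (u ∈ G.V0 → u' = σ l u) ∧ (u ∈ G.V1 → u' = π l u) ∧ (u ∈ G.Vp → G.E u u') := by
  unfold SASGame.step
  by_cases h0 : u ∈ G.V0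
  · have h1 := G.disj01.notMem_of_mem_left h0
    have hp := G.disj0p.notMem_of_mem_left h0
    simp [h0, h1, hp]
  · by_cases h1 : u ∈ G.V1
    · have hp := G.disj1p.notMem_of_mem_left h1
      simp [h0, h1, hp]
    · have hp := G.mem_Vp h0 h1
      simp [h0, h1, hp, ← G.κ_pos u hp, pos_iff_ne_zero]

theorem SASGame.cylProb_ne_zero_iff (G : SASGame V) (v : V) (σ π : Strat V) (h : ℕ → V)
    (n : ℕ) : G.cylProb v σ π h n ≠ 0 ↔
      h 0 = v ∧ ∀ i < n, G.step σ π (hist h i) (h i) (h (i + 1)) ≠ 0 := by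
  simp [SASGame.cylProb, Finset.prod_eq_zero_iff]

theorem SASGame.edge_of_step_ne_zero {G : SASGame V} {σ π : Strat V} (hσ : G.Valid0 σ)
    (hπ : G.Valid1 π) {l : List V} {u u' : V} (h : G.step σ π l u u' ≠ 0) : G.E u u' := by
  obtain ⟨h0, h1, hp⟩ := (G.step_ne_zero_iff σ π l u u').1 h
  by_cases hu0 : u ∈ G.V0
  · rw [h0 hu0]; exact hσ l u hu0
  by_cases hu1 : u ∈ G.V1
  · rw [h1 hu1]; exact hπ l u hu1
  · exact hp (G.mem_Vp hu0 hu1)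

theorem SASGame.IsPlayMeasure.shift {G : SASGame V} {v : V} {σ π : Strat V}
    {μ : Measure (ℕ → V)} (hμ : G.IsPlayMeasure v σ π μ) (h : ℕ → V) (k : ℕ)
    {σ' π' : Strat V} (hpos : μ (cyl h k) ≠ 0)
    (hσ : ∀ l u, σ (hist h k ++ l) u = σ' l u) (hπ : ∀ l u, π (hist h k ++ l) u = π' l u) :
    G.IsPlayMeasure (h k) σ' π'
      ((μ (cyl h k))⁻¹ • (μ.restrict (cyl h k)).map fun p n => p (k + n)) := by
  have := hμ.isProbabilityMeasure
  have hmeas : Measurable fun (p : ℕ → V) n => p (k + n) :=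
    measurable_pi_iff.2 fun n => measurable_pi_apply _
  have hinv : (μ (cyl h k))⁻¹ * μ (cyl h k) = 1 :=
    ENNReal.inv_mul_cancel hpos (measure_ne_top _ _)
  constructor
  · change ((μ (cyl h k))⁻¹ • (μ.restrict (cyl h k)).map fun p n => p (k + n)) Set.univ = 1
    rw [Measure.smul_apply, Measure.map_apply hmeas .univ, Set.preimage_univ,
      Measure.restrict_apply_univ, smul_eq_mul, hinv]
  intro h' n
  change ((μ (cyl h k))⁻¹ • (μ.restrict (cyl h k)).map fun p n => p (k + n)) (cyl h' n) = _
  rw [Measure.smul_apply, Measure.map_apply hmeas (measurableSet_cyl h' n),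
    Measure.restrict_apply (hmeas (measurableSet_cyl h' n)), smul_eq_mul]
  by_cases h0 : h' 0 = h k
  · have hset : (fun (p : ℕ → V) n => p (k + n)) ⁻¹' cyl h' n ∩ cyl h k =
        cyl (glue h k h') (k + n) := by
      ext p
      constructor
      · rintro ⟨h1, h2⟩ i hi
        rcases le_total i k with hik | hik
        · rw [glue_of_le h0 hik, h2 i hik]
        · obtain ⟨j, rfl⟩ := Nat.exists_eq_add_of_le hik
          rw [glue_add]
          exact h1 j (by omega)
      · intro H
        refine ⟨fun i hi => ?_, fun i hi => ?_⟩
        · have := H (k + i) (by omega)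
          rwa [glue_add] at this
        · rw [H i (by omega), glue_of_le h0 hi]
    have hprod : G.cylProb v σ π (glue h k h') (k + n) =
        G.cylProb v σ π h k * G.cylProb (h k) σ' π' h' n := by
      unfold SASGame.cylProb
      rw [Finset.prod_range_add, glue_of_le h0 (Nat.zero_le k), if_pos h0, one_mul, mul_assoc]
      congr 2
      · refine Finset.prod_congr rfl fun i hi => ?_
        rw [Finset.mem_range] at hi
        rw [glue_of_le h0 hi.le, glue_of_le h0 hi,
          hist_congr fun j hj => glue_of_le h0 (by omega)]
      · refine Finset.prod_congr rfl fun i _ => ?_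
        rw [hist_glue_add h0, glue_add, Nat.add_assoc, glue_add]
        unfold SASGame.step
        rw [hσ, hπ]
    rw [hset, hμ.cyl_eq (glue h k h') (k + n), hprod, ← hμ.cyl_eq h k, ← mul_assoc, hinv, one_mul]
  · have hset : (fun (p : ℕ → V) n => p (k + n)) ⁻¹' cyl h' n ∩ cyl h k = ∅ := by
      rw [Set.eq_empty_iff_forall_notMem]
      rintro p ⟨h1, h2⟩
      exact h0 ((h1 0 (Nat.zero_le n)).symm.trans (h2 k le_rfl))
    rw [hset, measure_empty, mul_zero, SASGame.cylProb, if_neg h0, zero_mul]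

/-- Player 0 wins from every configuration reachable under a winning strategy. -/
theorem SASGame.Wins0Via.residual {G : SASGame V} {v : V} {σ : Strat V} (H : G.Wins0Via v σ)
    {h : ℕ → V} {k : ℕ} (h0 : h 0 = v)
    (hE : ∀ i < k, G.E (h i) (h (i + 1)) ∧ (h i ∈ G.V0 → h (i + 1) = σ (hist h i) (h i))) :
    G.Wins0 (h k) := by
  obtain ⟨hval, hsure, has⟩ := H
  refine ⟨fun l u => σ (hist h k ++ l) u, fun l u hu => hval _ u hu, ?_, ?_⟩
  · rintro p ⟨p0, pE, pσ⟩
    have hq : glue h k p ∈ G.PlaysFrom v σ := by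
      refine ⟨by rw [glue_of_le p0 (Nat.zero_le k), h0], fun n => ?_, fun n hn => ?_⟩
      · rcases Nat.lt_or_ge n k with hn | hn
        · rw [glue_of_le p0 hn.le, glue_of_le p0 hn]
          exact (hE n hn).1
        · obtain ⟨j, rfl⟩ := Nat.exists_eq_add_of_le hn
          rw [Nat.add_assoc, glue_add, glue_add]
          exact pE j
      · rcases Nat.lt_or_ge n k with hnk | hnk
        · rw [glue_of_le p0 hnk.le] at hn
          rw [glue_of_le p0 hnk.le, glue_of_le p0 hnk,
            hist_congr fun j hj => glue_of_le p0 (by omega)]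
          exact (hE n hnk).2 hn
        · obtain ⟨j, rfl⟩ := Nat.exists_eq_add_of_le hnk
          rw [glue_add] at hn
          rw [Nat.add_assoc, glue_add, glue_add, hist_glue_add p0]
          exact pσ j hn
    have := (parityWin_shift G.ps (glue h k p) k).2 (hsure hq)
    simpa only [glue_add] using this
  · intro π hπ μ' hμ'
    let π' : Strat V := fun l u =>
      if l.length < k ∧ u = h l.length then h (l.length + 1) else π (l.drop k) u
    have hπ' : G.Valid1 π' := by
      intro l u hu
      simp only [π']
      split_ifs with hc
      · rw [hc.2]; exact (hE _ hc.1).1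
      · exact hπ _ u hu
    obtain ⟨μ, hμ⟩ := G.exists_isPlayMeasure v σ π'
    have := hμ.isProbabilityMeasure
    have hpos : μ (cyl h k) ≠ 0 := by
      rw [hμ.cyl_eq, G.cylProb_ne_zero_iff]
      refine ⟨h0, fun i hi => ?_⟩
      rw [G.step_ne_zero_iff]
      refine ⟨(hE i hi).2, fun _ => ?_, fun _ => (hE i hi).1⟩
      simp [π', hist_length, hi]
    have hν := hμ.shift h k (σ' := fun l u => σ (hist h k ++ l) u) (π' := π) hpos
      (fun _ _ => rfl) fun l u => by simp [π', hist_length]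
    have hwin : ∀ᵐ p ∂μ, p ∈ ParityWin G.pas :=
      (prob_compl_eq_zero_iff (measurableSet_parityWin G.pas)).2 (has π' hπ' μ hμ)
    have hmeas : Measurable fun (p : ℕ → V) n => p (k + n) :=
      measurable_pi_iff.2 fun n => measurable_pi_apply _
    rw [SASGame.IsPlayMeasure.unique hμ' hν]
    change ((μ (cyl h k))⁻¹ • (μ.restrict (cyl h k)).map fun p n => p (k + n))
      (ParityWin G.pas) = 1
    rw [Measure.smul_apply, Measure.map_apply hmeas (measurableSet_parityWin _),
      Measure.restrict_apply (hmeas (measurableSet_parityWin _)), smul_eq_mul]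
    have : μ ((fun (p : ℕ → V) n => p (k + n)) ⁻¹' ParityWin G.pas ∩ cyl h k) =
        μ (cyl h k) := by
      refine measure_congr ?_
      filter_upwards [hwin] with p hp
      exact propext ⟨fun h => h.2, fun h => ⟨(parityWin_shift _ p k).2 hp, h⟩⟩
    rw [this]
    exact ENNReal.inv_mul_cancel hpos (measure_ne_top _ _)

/-- The game in which, at the Player-1 configuration `w`, only the successor `x` (for
`c = true`) or only the other successors (for `c = false`) are kept. -/
def SASGame.restrict (G : SASGame V) {w x y : V} (hw : w ∈ G.V1) (hx : G.E w x) (hy : G.E w y)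
    (hxy : y ≠ x) (c : Bool) : SASGame V :=
  { G with
    E := fun a b => G.E a b ∧ (a = w → decide (b = x) = c)
    succ_nonempty := fun a => by
      by_cases ha : a = w
      · subst ha
        cases c
        · exact ⟨y, hy, fun _ => by simp [hxy]⟩
        · exact ⟨x, hx, fun _ => by simp⟩
      · obtain ⟨b, hb⟩ := G.succ_nonempty a
        exact ⟨b, hb, fun h => (ha h).elim⟩
    κ_pos := fun a ha b => by
      rw [G.κ_pos a ha b]
      exact ⟨fun h => ⟨h, fun h' => (G.disj1p.notMem_of_mem_left hw (h' ▸ ha)).elim⟩,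
        fun h => h.1⟩ }

theorem SASGame.ne_of_mem_V0 (G : SASGame V) {u w : V} (hw : w ∈ G.V1) (hu : u ∈ G.V0) :
    u ≠ w := fun h =>
  G.disj01.notMem_of_mem_left hu (h ▸ hw)

/-- In the merged game, the outcomes in one component being fixed, the choice of Player 1 in
the other component is determined by the past of that component. -/
theorem SASGame.next_eq_of_compPast_eq (G : SASGame V) {v w x : V} (hw : w ∈ G.V1)
    {σ π : Strat V} {c : Bool}
    {T' T₁ T₂ : List V × V → V} {p q : ℕ → V}
    (hp : p = run v (G.next σ π (mergedOutcomes w x c (T', T₁))))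
    (hq : q = run v (G.next σ π (mergedOutcomes w x c (T', T₂))))
    {m n : ℕ} (hm : comp w x p m = c) (hn : comp w x q n = c)
    (hpast : compPast w x p c m = compPast w x q c n) (hpq : p m = q n) (h1 : p m ∈ G.V1) :
    p (m + 1) = q (n + 1) := by
  have hp' : ∀ i, p (i + 1) = G.next σ π (mergedOutcomes w x c (T', T₁)) (hist p i) (p i) := by
    intro i; rw [hp]; exact run_succ _ _ _
  have hq' : ∀ i, q (i + 1) = G.next σ π (mergedOutcomes w x c (T', T₂)) (hist q i) (q i) := by
    intro i; rw [hq]; exact run_succ _ _ _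
  have hV1 : ∀ j, (∀ i ≤ j, p i = q i) → p j ∈ G.V1 → p (j + 1) = q (j + 1) := by
    intro j hj hj1
    have h0 := G.disj01.notMem_of_mem_right hj1
    rw [hp', hq', ← hj j le_rfl, hist_congr fun i hi => hj i (by omega)]
    simp [SASGame.next, h0, hj1]
  have hagree : ∀ j, j ≤ m → j ≤ n → ∀ i ≤ j, p i = q i := by
    intro j
    induction j with
    | zero =>
      intro _ _ i hi
      obtain rfl := Nat.le_zero.1 hi
      rw [hp, hq, run_zero, run_zero]
    | succ j ih =>
      intro hjm hjn i hi
      have ih := ih (by omega) (by omega)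
      rcases Nat.le_succ_iff.1 hi with hi | rfl
      · exact ih i hi
      by_cases h1 : p j ∈ G.V1
      · exact hV1 j ih h1
      have hjw : p j ≠ w := fun h => h1 (h ▸ hw)
      have hjw' : q j ≠ w := ih j le_rfl ▸ hjw
      have hcomp : comp w x p j = comp w x q j :=
        comp_congr ih fun h => (hjw h).elim
      by_cases hjc : comp w x p j = c
      · have e1 := compPast_next (w := w) (x := x) (by omega : j < m) hjc hm
        have e2 := compPast_next (w := w) (x := x) (by omega : j < n) (hcomp.symm.trans hjc) hn
        rw [hpast, hpq, compPast_congr ih] at e1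
        exact Option.some_injective _ (e1.symm.trans e2)
      · rw [hp', hq']
        unfold SASGame.next
        rw [mergedOutcomes, mergedOutcomes, merge_hist _ hjw, merge_hist _ hjw', ← hcomp,
          ← ih j le_rfl, ← compPast_congr ih, hist_congr fun i hi => ih i (by omega)]
        simp [twoOutcomes, hjc]
  have hmn : m = n := by
    by_contra hne
    rcases Nat.lt_or_gt_of_ne hne with hlt | hlt
    · have hag := hagree m le_rfl hlt.le
      have hc : comp w x q m = c := by
        rw [← hm]
        exact (comp_congr hag fun _ => hV1 m hag h1).symm
      have := compPast_length_lt hlt hc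
      rw [← hpast, ← compPast_congr hag] at this
      exact this.false
    · have hag := hagree n hlt.le le_rfl
      have hc : comp w x p n = c := by
        rw [← hn]
        exact comp_congr hag fun _ => hV1 n hag (hag n le_rfl ▸ hpq ▸ h1)
      have := compPast_length_lt hlt hc
      rw [hpast, compPast_congr hag] at this
      exact this.false
  subst hmn
  exact hV1 m (hagree m le_rfl le_rfl) h1

section Restrict

variable (G : SASGame V) {w x y : V} (hw : w ∈ G.V1) (hx : G.E w x) (hy : G.E w y)
  (hxy : y ≠ x)

theorem SASGame.Wins1Via.of_restrict {v : V} {π : Strat V} {c : Bool}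
    (H : (G.restrict hw hx hy hxy c).Wins1Via v π) : G.Wins1Via v π := by
  obtain ⟨hval, H⟩ := H
  refine ⟨fun h u hu => (hval h u hu).1, fun σ hσ => ?_⟩
  rcases H σ (fun h u hu => ⟨hσ h u hu, fun h' => (G.ne_of_mem_V0 hw hu h').elim⟩) with
    ⟨p, ⟨⟨p0, pE, pσ⟩, pπ⟩, hp⟩ | H
  · exact .inl ⟨p, ⟨⟨p0, fun n => (pE n).1, pσ⟩, pπ⟩, hp⟩
  · exact .inr H

/-- If `w` cannot be reached under a strategy winning in a restricted game, then the strategy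
is winning. -/
theorem SASGame.Wins0Via.of_restrict {v : V} {σ : Strat V} {c : Bool}
    (H : (G.restrict hw hx hy hxy c).Wins0Via v σ)
    (hreach : ∀ (h : ℕ → V) (k : ℕ), h 0 = v → (∀ i < k, h i ≠ w ∧ G.E (h i) (h (i + 1)) ∧
      (h i ∈ G.V0 → h (i + 1) = σ (hist h i) (h i))) → h k ≠ w) :
    G.Wins0Via v σ := by
  have hreach' : ∀ (h : ℕ → V) (k : ℕ), h 0 = v → (∀ i < k, G.E (h i) (h (i + 1)) ∧
      (h i ∈ G.V0 → h (i + 1) = σ (hist h i) (h i))) → ∀ i ≤ k, h i ≠ w := by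
    intro h k h0 hE i
    induction i using Nat.strong_induction_on with
    | _ i ih =>
      intro hi
      exact hreach h i h0 fun j hj => ⟨ih j hj (by omega), hE j (by omega)⟩
  obtain ⟨hval, hsure, has⟩ := H
  have hval' : G.Valid0 σ := fun h u hu => (hval h u hu).1
  refine ⟨hval', ?_, fun π hπ μ hμ => ?_⟩
  · rintro p ⟨p0, pE, pσ⟩
    refine hsure ⟨p0, fun n => ⟨pE n, fun hn => ?_⟩, pσ⟩
    exact (hreach' p n p0 (fun i _ => ⟨pE i, pσ i⟩) n le_rfl hn).elim
  · obtain ⟨z, hz⟩ := (G.restrict hw hx hy hxy c).succ_nonempty w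
    let π' : Strat V := fun h u => if u = w then z else π h u
    have hπ' : (G.restrict hw hx hy hxy c).Valid1 π' := by
      intro h u hu
      simp only [π']
      split_ifs with huw
      · rw [huw]; exact hz
      · exact ⟨hπ h u hu, fun h' => (huw h').elim⟩
    refine has π' hπ' μ ⟨hμ.1, fun h n => (hμ.2 h n).trans ?_⟩
    change G.cylProb v σ π h n = G.cylProb v σ π' h n
    by_cases hvis : ∀ i < n, h i ≠ w
    · unfold SASGame.cylProb
      congr 1
      refine Finset.prod_congr rfl fun i hi => ?_
      unfold SASGame.step
      simp only [π', if_neg (hvis i (Finset.mem_range.1 hi))]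
    · have hzero : ∀ π'', G.Valid1 π'' → G.cylProb v σ π'' h n = 0 := by
        intro π'' hπ''
        by_contra hne
        obtain ⟨h0, hstep⟩ := (G.cylProb_ne_zero_iff v σ π'' h n).1 hne
        refine hvis fun i hi => hreach' h n h0 (fun j hj => ⟨?_, ?_⟩) i hi.le
        · exact edge_of_step_ne_zero hval' hπ'' (hstep j hj)
        · exact ((G.step_ne_zero_iff _ _ _ _ _).1 (hstep j hj)).1
      rw [hzero π hπ, hzero π' fun h u hu => (hπ' h u hu).1]

theorem SASGame.valid0_merge {v : V} {S : Bool → Strat V}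
    (hS : ∀ c, (G.restrict hw hx hy hxy c).Wins0Via (compStart v w c) (S c)) :
    G.Valid0 (merge w x S) := fun _ u hu =>
  ((hS _).1 _ u hu).1

theorem SASGame.parityWin_of_merge {v : V} {S : Bool → Strat V}
    (hS : ∀ c, (G.restrict hw hx hy hxy c).Wins0Via (compStart v w c) (S c))
    {p : ℕ → V} (hp : p ∈ G.PlaysFrom v (merge w x S)) :
    p ∈ ParityWin G.ps := by
  obtain ⟨p0, pE, pσ⟩ := hp
  refine parityWin_of_components (w := w) (x := x) fun c hne => ?_
  have hinf := infinite_of_mem_InfComp hne.some_mem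
  have hproj : proj w x p c ∈ (G.restrict hw hx hy hxy c).PlaysFrom (compStart v w c) (S c) := by
    refine ⟨by rw [proj_zero hinf, p0], fun k => ?_, fun k hk => ?_⟩
    · rw [proj_succ hinf]
      refine ⟨pE _, fun h => ?_⟩
      exact (comp_of_eq (p := p) (n := Nat.nth (fun n => comp w x p n = c) k) h).symm.trans
        (Nat.nth_mem_of_infinite hinf k)
    · have hc := Nat.nth_mem_of_infinite hinf k
      have hk' : p (Nat.nth (fun n => comp w x p n = c) k) ≠ w := G.ne_of_mem_V0 hw hk
      rw [proj_succ hinf, hist_proj hinf, pσ _ hk, merge_hist _ hk', hc]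
      rfl
  have := (hS c).2.1 hproj
  change Even (sInf (G.ps '' InfOcc (proj w x p c))) at this
  rwa [InfOcc_proj hinf] at this

theorem SASGame.ae_component {v : V} {S : Bool → Strat V}
    (hS : ∀ c, (G.restrict hw hx hy hxy c).Wins0Via (compStart v w c) (S c))
    {π : Strat V} (hπ : G.Valid1 π) (c : Bool)
    (T' : List V × V → V) :
    ∀ᵐ T ∂G.nature, let p := run v (G.next (merge w x S) π (mergedOutcomes w x c (T', T)))
      (InfComp w x c p).Nonempty → Even (sInf (G.pas '' InfComp w x c p)) := by
  set P : (List V × V → V) → ℕ → V := fun T =>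
    run v (G.next (merge w x S) π (mergedOutcomes w x c (T', T))) with hP
  let G' := G.restrict hw hx hy hxy c
  let π' : Strat V := fun h u =>
    if H : ∃ (T : List V × V → V) (n : ℕ),
        comp w x (P T) n = c ∧ compPast w x (P T) c n = h ∧ P T n = u
    then P H.choose (H.choose_spec.choose + 1)
    else (G'.succ_nonempty u).choose
  have hnext : ∀ T n, P T (n + 1) = G.next (merge w x S) π (mergedOutcomes w x c (T', T))
      (hist (P T) n) (P T n) := fun T n => run_succ _ _ _
  have hπ' : G'.Valid1 π' := by
    intro h u hu
    simp only [π']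
    split_ifs with H
    · obtain ⟨hc, -, hu'⟩ := H.choose_spec.choose_spec
      set T := H.choose
      set n := H.choose_spec.choose
      have hu1 : u ∈ G.V1 := hu
      refine ⟨?_, fun h => ?_⟩
      · rw [hnext, hu', SASGame.next, if_neg (G.disj01.notMem_of_mem_right hu1), if_pos hu1]
        exact hπ _ u hu
      · exact (comp_of_eq (hu'.trans h)).symm.trans hc
    · exact (G'.succ_nonempty u).choose_spec
  have hπ'_eq : ∀ T n, comp w x (P T) n = c → P T n ∈ G.V1 →
      π' (compPast w x (P T) c n) (P T n) = P T (n + 1) := by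
    intro T n hc h1
    have H : ∃ (T₁ : List V × V → V) (m : ℕ), comp w x (P T₁) m = c ∧
        compPast w x (P T₁) c m = compPast w x (P T) c n ∧ P T₁ m = P T n :=
      ⟨T, n, hc, rfl, rfl⟩
    simp only [π', dif_pos H]
    obtain ⟨hc', hpast, hu⟩ := H.choose_spec.choose_spec
    have h1' : P H.choose H.choose_spec.choose ∈ G.V1 := by rw [hu]; exact h1
    exact G.next_eq_of_compPast_eq hw rfl rfl hc' hc hpast hu h1'
  obtain ⟨hmeas, hlaw⟩ := G'.isPlayMeasure_nature (compStart v w c) (S c) π'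
  have := hlaw.isProbabilityMeasure
  have hae := (prob_compl_eq_zero_iff (measurableSet_parityWin G'.pas)).2
    ((hS c).2.2 π' hπ' _ hlaw)
  have hae' : ∀ᵐ T ∂G.nature, run (compStart v w c)
      (G'.next (S c) π' fun h u => T (h, u)) ∈ ParityWin G.pas :=
    ae_of_ae_map hmeas.aemeasurable hae
  filter_upwards [hae'] with T hT
  intro p hne
  have hinf := infinite_of_mem_InfComp hne.some_mem
  have hproj : proj w x p c = run (compStart v w c) (G'.next (S c) π' fun h u => T (h, u)) := by
    refine eq_run ?_ fun k => ?_
    · rw [proj_zero hinf]; rfl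
    · have hc := Nat.nth_mem_of_infinite hinf k
      rw [proj_succ hinf, hist_proj hinf]
      simp only [proj]
      generalize Nat.nth (fun n => comp w x p n = c) k = t at hc ⊢
      change G'.next (S c) π' (fun h u => T (h, u)) (compPast w x (P T) c t) (P T t) =
        P T (t + 1)
      rw [hnext T t]
      unfold SASGame.next
      change (if P T t ∈ G.V0 then _ else if P T t ∈ G.V1 then _ else _) = _
      split_ifs with h0 h1
      · rw [merge_hist _ (G.ne_of_mem_V0 hw h0), hc]
      · rw [hπ'_eq T t hc h1, hnext T t, SASGame.next, if_neg h0, if_pos h1]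
      · rw [mergedOutcomes, merge_hist _ fun h : P T t = w => h1 (by rw [h]; exact hw), hc]
        simp [twoOutcomes, hP]
  rw [← hproj] at hT
  change Even (sInf (G.pas '' InfOcc (proj w x p c))) at hT
  rwa [InfOcc_proj hinf] at hT

/-- If Player 0 wins from `v` in the first restricted game and from `w` in the second one,
then she wins from `v`. -/
theorem SASGame.wins0Via_merge {v : V} {S : Bool → Strat V}
    (hS : ∀ c, (G.restrict hw hx hy hxy c).Wins0Via (compStart v w c) (S c)) :
    G.Wins0Via v (merge w x S) := by
  refine ⟨G.valid0_merge hw hx hy hxy hS, fun p hp => G.parityWin_of_merge hw hx hy hxy hS hp,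
    fun π hπ μ hμ => ?_⟩
  have := hμ.isProbabilityMeasure
  have hbad : ∀ c, ∀ᵐ p ∂μ,
      (InfComp w x c p).Nonempty → Even (sInf (G.pas '' InfComp w x c p)) := by
    intro c
    obtain ⟨hmeas, hlaw⟩ := G.isPlayMeasure_merged v (merge w x S) π hw x c
    rw [hμ.unique hlaw, ae_iff]
    refine (Measure.map_apply hmeas (measurableSet_bad_component w x c G.pas)).trans ?_
    rw [Measure.measure_prod_null (hmeas (measurableSet_bad_component w x c G.pas))]
    exact .of_forall fun T' => G.ae_component hw hx hy hxy hS hπ c T'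
  refine (prob_compl_eq_zero_iff (measurableSet_parityWin G.pas)).1 ?_
  change ∀ᵐ p ∂μ, p ∈ ParityWin G.pas
  filter_upwards [hbad true, hbad false] with p h1 h2
  exact parityWin_of_components (w := w) (x := x) fun c => by cases c <;> assumption

end Restrict

/-- If Player 1 has no choice, then either Player 0 wins or every strategy of Player 1 is
winning. -/
theorem SASGame.determined_of_unique_succ (G : SASGame V) (v : V)
    (huniq : ∀ w ∈ G.V1, ∀ x y, G.E w x → G.E w y → y = x) :
    G.Wins0 v ∨ ∃ π, Memoryless π ∧ G.Wins1Via v π := by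
  refine or_iff_not_imp_left.2 fun hno => ?_
  let π : Strat V := fun _ u => (G.succ_nonempty u).choose
  have hπ : G.Valid1 π := fun _ u _ => (G.succ_nonempty u).choose_spec
  refine ⟨π, fun _ _ _ => rfl, hπ, fun σ hσ => or_iff_not_imp_left.2 fun hsure μ hμ => ?_⟩
  have hle : μ (ParityWin G.pas) ≤ 1 := (measure_mono (Set.subset_univ _)).trans hμ.1.le
  refine lt_of_le_of_ne hle fun hone => hno ⟨σ, hσ, fun p hp => ?_, fun π' hπ' ν hν => ?_⟩
  · by_contra hbad
    exact hsure ⟨p, ⟨hp, fun n hn => huniq _ hn _ _ (hπ (hist p n) _ hn) (hp.2.1 n)⟩, hbad⟩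
  · have hstep : G.step σ π' = G.step σ π := by
      funext l u u'
      unfold SASGame.step
      by_cases h1 : u ∈ G.V1
      · rw [huniq u h1 _ _ (hπ l u h1) (hπ' l u h1)]
      · rw [if_neg h1, if_neg h1]
    have hν' : G.IsPlayMeasure v σ π ν := by
      refine ⟨hν.1, fun h n => (hν.2 h n).trans ?_⟩
      rw [SASGame.cylProb, SASGame.cylProb, hstep]
    rw [hν'.unique hμ]
    exact hone

/-- The number of edges leaving the configurations of Player 1. -/
noncomputable def SASGame.numChoices (G : SASGame V) : ℕ :=
  Set.ncard {e : V × V | e.1 ∈ G.V1 ∧ G.E e.1 e.2}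

theorem SASGame.numChoices_restrict_lt (G : SASGame V) {w x y : V} (hw : w ∈ G.V1)
    (hx : G.E w x) (hy : G.E w y) (hxy : y ≠ x) (c : Bool) :
    (G.restrict hw hx hy hxy c).numChoices < G.numChoices := by
  refine Set.ncard_lt_ncard ⟨fun e he => ⟨he.1, he.2.1⟩, fun hsub => ?_⟩ (Set.toFinite _)
  cases c
  · have := (hsub (show (w, x) ∈ _ from ⟨hw, hx⟩)).2.2 rfl
    simp at this
  · have := (hsub (show (w, y) ∈ _ from ⟨hw, hy⟩)).2.2 rfl
    simp [hxy] at this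

/-- Either Player 0 wins or Player 1 has a memoryless winning strategy. -/
theorem SASGame.wins0_or_memoryless (G : SASGame V) (v : V) :
    G.Wins0 v ∨ ∃ π, Memoryless π ∧ G.Wins1Via v π := by
  induction hn : G.numChoices using Nat.strong_induction_on generalizing G v with
  | _ n ih =>
    subst hn
    by_cases huniq : ∀ w ∈ G.V1, ∀ x y, G.E w x → G.E w y → y = x
    · exact G.determined_of_unique_succ v huniq
    push Not at huniq
    obtain ⟨w, hw, x, y, hx, hy, hxy⟩ := huniq
    have hres : ∀ c, (∃ σ, (G.restrict hw hx hy hxy c).Wins0Via v σ) ∨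
        ∃ π, Memoryless π ∧ G.Wins1Via v π := fun c =>
      (ih _ (G.numChoices_restrict_lt hw hx hy hxy c) _ v rfl).imp id
        fun ⟨π, hm, hπ⟩ => ⟨π, hm, hπ.of_restrict G hw hx hy hxy⟩
    rcases hres true with ⟨σ₁, h₁⟩ | h
    swap
    · exact .inr h
    rcases hres false with ⟨σ₂, h₂⟩ | h
    swap
    · exact .inr h
    left
    by_cases hreach : ∀ (h : ℕ → V) (k : ℕ), h 0 = v → (∀ i < k, h i ≠ w ∧
        G.E (h i) (h (i + 1)) ∧ (h i ∈ G.V0 → h (i + 1) = σ₂ (hist h i) (h i))) → h k ≠ w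
    · exact ⟨σ₂, h₂.of_restrict G hw hx hy hxy hreach⟩
    push Not at hreach
    obtain ⟨h, k, h0, hE, hk⟩ := hreach
    obtain ⟨σ₃, h₃⟩ := h₂.residual h0 fun i hi =>
      ⟨⟨(hE i hi).2.1, fun h' => ((hE i hi).1 h').elim⟩, (hE i hi).2.2⟩
    rw [hk] at h₃
    refine ⟨_, G.wins0Via_merge hw hx hy hxy (S := fun c => if c then σ₁ else σ₃) fun c => ?_⟩
    cases c
    · exact h₃
    · exact h₁

end Measure

/-- in a finite SAS parity game, memoryless strategies suffice for
Player 1: if Player 1 wins from `v`, then she has a memoryless strategy `π` such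
that for every Player-0 strategy `σ`, either some play from `v` consistent with
`σ` and `π` is not in the sure parity condition, or the probability of the
almost-sure parity condition in `v(σ,π)` is less than 1. -/
theorem sas_player_one_memoryless (G : SASGame V) (v : V) (h : G.Wins1 v) :
    ∃ π, Memoryless π ∧ G.Wins1Via v π := by
  refine (G.wins0_or_memoryless v).resolve_left fun ⟨σ, hσ, hsure, has⟩ => ?_
  obtain ⟨π, hπ, H⟩ := h
  rcases H σ hσ with ⟨p, hp, hbad⟩ | H
  · exact hbad (hsure hp.1)
  · obtain ⟨μ, hμ⟩ := G.exists_isPlayMeasure v σ π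
    exact (H μ hμ).ne (has π hπ μ hμ)
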